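/- arXiv:1903.05179 — 2 statements merged into one kernel-verified Lean document; each statement's English description precedes it below -/
import Mathlib

section
/- Let (Ω, ℱ, P) be a probability space. Let ω_l, ω_r ≥ 0 be real numbers and set ω_m = ω_l + ω_r. Let p_m, p_l, p_r be integrable real-valued random variables satisfying ω_m·p_m = ω_l·p_l + ω_r·p_r almost surely, and let p'_m, p'_l, p'_r be integrable real-valued random variables with a common expectation E[p'_m] = E[p'_l] = E[p'_r] = q, such that for each s ∈ {m, l, r} the random variables p_s and p'_s are independent and the product p_s·p'_s is integrable. Then the expected test-set split-improvement vanishes: E[ω_m·H'(p_m, p'_m) − ω_l·H'(p_l, p'_l) − ω_r·H'(p_r, p'_r)] = 0. -/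
open MeasureTheory ProbabilityTheory

/-- Predictive Gini impurity evaluated with training proportion `p` and
test proportion `p'`: `H'(p, p') = 1 - p·p' - (1-p)·(1-p')`. -/
noncomputable def predGini (p p' : ℝ) : ℝ := 1 - p * p' - (1 - p) * (1 - p')

/-- For independent proportions, the predictive Gini impurity is integrable and its expectation
is the predictive Gini impurity of the expectations. -/
theorem integral_predGini {Ω : Type*} [MeasurableSpace Ω] {μ : Measure Ω}
    [IsProbabilityMeasure μ] {p p' : Ω → ℝ} (hp : Integrable p μ) (hp' : Integrable p' μ)
    (hind : IndepFun p p' μ) (hint : Integrable (fun ω => p ω * p' ω) μ) :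
    Integrable (fun ω => predGini (p ω) (p' ω)) μ ∧
      ∫ ω, predGini (p ω) (p' ω) ∂μ = predGini (∫ ω, p ω ∂μ) (∫ ω, p' ω ∂μ) := by
  have heq : (fun ω => predGini (p ω) (p' ω)) = fun ω => p ω + p' ω - 2 * (p ω * p' ω) := by
    funext ω
    simp only [predGini]
    ring
  have hsum : Integrable (fun ω => p ω + p' ω) μ := hp.add hp'
  rw [heq]
  refine ⟨hsum.sub (hint.const_mul 2), ?_⟩
  rw [integral_sub hsum (hint.const_mul 2), integral_add hp hp', integral_const_mul,
    hind.integral_fun_mul_eq_mul_integral hp.aestronglyMeasurable hp'.aestronglyMeasurable]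
  simp only [predGini]
  ring

/-- Lemma 1 (classification): if the training/test class proportions of parent node `m`
and child nodes `l`, `r` satisfy the weighted-average identity, the test proportions have a
common expectation, and training proportions are independent of test proportions, then the
expected predictive split-improvement is zero. -/
theorem unbiased_split_improvement_classification
    {Ω : Type*} [MeasureSpace Ω] [IsProbabilityMeasure (ℙ : Measure Ω)]
    (ωl ωr : ℝ) (hωl : 0 ≤ ωl) (hωr : 0 ≤ ωr)
    (pm pl pr pm' pl' pr' : Ω → ℝ)
    (hpm : Integrable pm) (hpl : Integrable pl) (hpr : Integrable pr)
    (hpm' : Integrable pm') (hpl' : Integrable pl') (hpr' : Integrable pr')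
    (hsplit : ∀ᵐ ω ∂ℙ, (ωl + ωr) * pm ω = ωl * pl ω + ωr * pr ω)
    (q : ℝ)
    (hqm : ∫ ω, pm' ω = q) (hql : ∫ ω, pl' ω = q) (hqr : ∫ ω, pr' ω = q)
    (hindm : IndepFun pm pm') (hindl : IndepFun pl pl') (hindr : IndepFun pr pr')
    (hintm : Integrable (fun ω => pm ω * pm' ω))
    (hintl : Integrable (fun ω => pl ω * pl' ω))
    (hintr : Integrable (fun ω => pr ω * pr' ω)) :
    ∫ ω, ((ωl + ωr) * predGini (pm ω) (pm' ω)
        - ωl * predGini (pl ω) (pl' ω)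
        - ωr * predGini (pr ω) (pr' ω)) = 0 := by
  obtain ⟨him, hm⟩ := integral_predGini hpm hpm' hindm hintm
  obtain ⟨hil, hl⟩ := integral_predGini hpl hpl' hindl hintl
  obtain ⟨hir, hr⟩ := integral_predGini hpr hpr' hindr hintr
  have hmean : (ωl + ωr) * ∫ ω, pm ω = ωl * (∫ ω, pl ω) + ωr * ∫ ω, pr ω := by
    rw [← integral_const_mul, integral_congr_ae hsplit,
      integral_add (hpl.const_mul ωl) (hpr.const_mul ωr), integral_const_mul,
      integral_const_mul]
  have hdiff : Integrable (fun ω => (ωl + ωr) * predGini (pm ω) (pm' ω)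
      - ωl * predGini (pl ω) (pl' ω)) :=
    (him.const_mul _).sub (hil.const_mul _)
  rw [integral_sub hdiff (hir.const_mul _),
    integral_sub (him.const_mul _) (hil.const_mul _), integral_const_mul, integral_const_mul,
    integral_const_mul, hm, hl, hr, hqm, hql, hqr]
  simp only [predGini]
  linear_combination (1 - 2 * q) * hmean
end

section
/- Let (Ω, ℱ, P) be a probability space and K a finite index set (the internal nodes of a tree that split on a given feature). For each k ∈ K, let ω_l^k, ω_r^k ≥ 0 be real numbers with ω_m^k = ω_l^k + ω_r^k, let p_m^k, p_l^k, p_r^k be integrable real random variables with ω_m^k·p_m^k = ω_l^k·p_l^k + ω_r^k·p_r^k almost surely, and let p'^k_m, p'^k_l, p'^k_r be integrable real random variables with E[p'^k_m] = E[p'^k_l] = E[p'^k_r] = q_k, such that for each s ∈ {m, l, r} the variables p_s^k and p'^k_s are independent with p_s^k·p'^k_s integrable. Define Δ'_k = ω_m^k·H'(p_m^k, p'^k_m) − ω_l^k·H'(p_l^k, p'^k_l) − ω_r^k·H'(p_r^k, p'^k_r). Then E[Σ_{k ∈ K} Δ'_k] = 0. -/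
open MeasureTheory ProbabilityTheory

/-- The predictive Gini impurity of two integrable random variables with integrable product is
integrable. -/
theorem integrable_predGini {Ω : Type*} [MeasurableSpace Ω] {μ : Measure Ω} {p p' : Ω → ℝ}
    (hp : Integrable p μ) (hp' : Integrable p' μ)
    (hmul : Integrable (fun ω => p ω * p' ω) μ) :
    Integrable (fun ω => predGini (p ω) (p' ω)) μ := by
  have h := (hp.fun_add hp').sub (hmul.const_mul 2)
  refine h.congr (.of_forall fun ω => ?_)
  simp only [predGini, Pi.sub_apply]
  ring

/-- The expected predictive Gini impurity of independent random variables is the predictive Gini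
impurity of their expectations. -/
theorem integral_predGini_of_indepFun {Ω : Type*} [MeasurableSpace Ω] {μ : Measure Ω}
    {p p' : Ω → ℝ} (hp : Integrable p μ) (hp' : Integrable p' μ)
    (hmul : Integrable (fun ω => p ω * p' ω) μ) (hind : IndepFun p p' μ) :
    ∫ ω, predGini (p ω) (p' ω) ∂μ = predGini (∫ ω, p ω ∂μ) (∫ ω, p' ω ∂μ) := by
  have hprod : ∫ ω, p ω * p' ω ∂μ = (∫ ω, p ω ∂μ) * ∫ ω, p' ω ∂μ :=
    hind.integral_fun_mul_eq_mul_integral hp.aestronglyMeasurable hp'.aestronglyMeasurable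
  calc ∫ ω, predGini (p ω) (p' ω) ∂μ = ∫ ω, (p ω + p' ω - 2 * (p ω * p' ω)) ∂μ := by
        congr with ω
        simp only [predGini]
        ring
    _ = predGini (∫ ω, p ω ∂μ) (∫ ω, p' ω ∂μ) := by
        rw [integral_sub (hp.fun_add hp') (hmul.const_mul 2), integral_add hp hp',
          integral_const_mul, hprod, predGini]
        ring

/-- Theorem 1 (classification): summing the unbiased split-improvements `Δ'_k` over all
nodes `k ∈ K` splitting on a feature independent of the response yields expectation zero. -/
theorem unbiased_split_improvement_classification_tree
    {Ω : Type*} [MeasureSpace Ω] [IsProbabilityMeasure (ℙ : Measure Ω)]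
    {ι : Type*} (K : Finset ι)
    (ωl ωr : ι → ℝ) (hωl : ∀ k ∈ K, 0 ≤ ωl k) (hωr : ∀ k ∈ K, 0 ≤ ωr k)
    (pm pl pr pm' pl' pr' : ι → Ω → ℝ)
    (hpm : ∀ k ∈ K, Integrable (pm k)) (hpl : ∀ k ∈ K, Integrable (pl k))
    (hpr : ∀ k ∈ K, Integrable (pr k))
    (hpm' : ∀ k ∈ K, Integrable (pm' k)) (hpl' : ∀ k ∈ K, Integrable (pl' k))
    (hpr' : ∀ k ∈ K, Integrable (pr' k))
    (hsplit : ∀ k ∈ K, ∀ᵐ ω ∂ℙ, (ωl k + ωr k) * pm k ω = ωl k * pl k ω + ωr k * pr k ω)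
    (q : ι → ℝ)
    (hqm : ∀ k ∈ K, ∫ ω, pm' k ω = q k) (hql : ∀ k ∈ K, ∫ ω, pl' k ω = q k)
    (hqr : ∀ k ∈ K, ∫ ω, pr' k ω = q k)
    (hindm : ∀ k ∈ K, IndepFun (pm k) (pm' k)) (hindl : ∀ k ∈ K, IndepFun (pl k) (pl' k))
    (hindr : ∀ k ∈ K, IndepFun (pr k) (pr' k))
    (hintm : ∀ k ∈ K, Integrable (fun ω => pm k ω * pm' k ω))
    (hintl : ∀ k ∈ K, Integrable (fun ω => pl k ω * pl' k ω))
    (hintr : ∀ k ∈ K, Integrable (fun ω => pr k ω * pr' k ω)) :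
    ∫ ω, ∑ k ∈ K, ((ωl k + ωr k) * predGini (pm k ω) (pm' k ω)
        - ωl k * predGini (pl k ω) (pl' k ω)
        - ωr k * predGini (pr k ω) (pr' k ω)) = 0 := by
  have hm k (hk : k ∈ K) := (integrable_predGini (hpm k hk) (hpm' k hk) (hintm k hk)).const_mul
    (ωl k + ωr k)
  have hl k (hk : k ∈ K) := (integrable_predGini (hpl k hk) (hpl' k hk) (hintl k hk)).const_mul
    (ωl k)
  have hr k (hk : k ∈ K) := (integrable_predGini (hpr k hk) (hpr' k hk) (hintr k hk)).const_mul
    (ωr k)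
  have hml k (hk : k ∈ K) : Integrable fun ω =>
      (ωl k + ωr k) * predGini (pm k ω) (pm' k ω) - ωl k * predGini (pl k ω) (pl' k ω) :=
    (hm k hk).sub (hl k hk)
  have hΔ k (hk : k ∈ K) : Integrable fun ω => (ωl k + ωr k) * predGini (pm k ω) (pm' k ω)
      - ωl k * predGini (pl k ω) (pl' k ω) - ωr k * predGini (pr k ω) (pr' k ω) :=
    (hml k hk).sub (hr k hk)
  rw [integral_finsetSum K hΔ]
  refine Finset.sum_eq_zero fun k hk => ?_
  have hmean : (ωl k + ωr k) * ∫ ω, pm k ω = ωl k * (∫ ω, pl k ω) + ωr k * ∫ ω, pr k ω := by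
    rw [← integral_const_mul, integral_congr_ae (hsplit k hk),
      integral_add ((hpl k hk).const_mul _) ((hpr k hk).const_mul _), integral_const_mul,
      integral_const_mul]
  rw [integral_sub (hml k hk) (hr k hk), integral_sub (hm k hk) (hl k hk),
    integral_const_mul, integral_const_mul, integral_const_mul,
    integral_predGini_of_indepFun (hpm k hk) (hpm' k hk) (hintm k hk) (hindm k hk),
    integral_predGini_of_indepFun (hpl k hk) (hpl' k hk) (hintl k hk) (hindl k hk),
    integral_predGini_of_indepFun (hpr k hk) (hpr' k hk) (hintr k hk) (hindr k hk),
    hqm k hk, hql k hk, hqr k hk]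
  simp only [predGini]
  linear_combination (1 - 2 * q k) * hmean
end
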